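/- Let A and B be associative, not necessarily unital ℂ-algebras, let E be a right functional A-module whose functional space Θ_A(E) is cofull, assume A has a left approximate unit and that the compact operator algebra K_A(E) has a right approximate unit, and let π : A → B be an algebra homomorphism. Then K_B(E ⊗_π B) has a right approximate unit. -/

import Mathlib

open scoped BigOperators TensorProduct

noncomputable section

/-- A right module structure for a (not necessarily unital) ℂ-algebra `A`
on a ℂ-vector space `E`. -/
structure RightMod (A : Type*) [NonUnitalRing A] [Module ℂ A]
    (E : Type*) [AddCommGroup E] [Module ℂ E] where
  sm : E → A → E
  add_sm : ∀ (x y : E) (a : A), sm (x + y) a = sm x a + sm y a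
  sm_add : ∀ (x : E) (a b : A), sm x (a + b) = sm x a + sm x b
  sm_mul : ∀ (x : E) (a b : A), sm (sm x a) b = sm x (a * b)
  csm_left : ∀ (c : ℂ) (x : E) (a : A), sm (c • x) a = c • sm x a
  csm_right : ∀ (c : ℂ) (x : E) (a : A), sm x (c • a) = c • sm x a

variable {A : Type*} [NonUnitalRing A] [Module ℂ A]

/-- `f : E → A` is a right `A`-module homomorphism into the standard module `A`. -/
def IsFunctional {E : Type*} [AddCommGroup E] [Module ℂ E]
    (r : RightMod A E) (f : E → A) : Prop :=
  (∀ x y : E, f (x + y) = f x + f y) ∧ (∀ (c : ℂ) (x : E), f (c • x) = c • f x) ∧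
    ∀ (x : E) (a : A), f (r.sm x a) = f x * a

/-- `Θ` is a functional space for the right `A`-module `(E, r)`:
a `G`-invariant left `A`-submodule of `Hom_A(E,A)`. -/
structure IsFunctionalSpace {E : Type*} [AddCommGroup E] [Module ℂ E]
    (r : RightMod A E) (Θ : Set (E → A)) : Prop where
  functional : ∀ φ ∈ Θ, IsFunctional r φ
  zero_mem : (0 : E → A) ∈ Θ
  add_mem : ∀ {φ ψ : E → A}, φ ∈ Θ → ψ ∈ Θ → φ + ψ ∈ Θ
  neg_mem : ∀ {φ : E → A}, φ ∈ Θ → -φ ∈ Θ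
  csmul_mem : ∀ (c : ℂ) {φ : E → A}, φ ∈ Θ → c • φ ∈ Θ
  lsmul_mem : ∀ (a : A) {φ : E → A}, φ ∈ Θ → (fun x => a * φ x) ∈ Θ

/-- Right `A`-module homomorphism between two right `A`-modules. -/
def IsModHom {E F : Type*} [AddCommGroup E] [Module ℂ E] [AddCommGroup F] [Module ℂ F]
    (rE : RightMod A E) (rF : RightMod A F) (U : E → F) : Prop :=
  (∀ x y : E, U (x + y) = U x + U y) ∧ (∀ (c : ℂ) (x : E), U (c • x) = c • U x) ∧
    ∀ (x : E) (a : A), U (rE.sm x a) = rF.sm (U x) a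

/-- A homomorphism of functional modules `(U, U^*)`. -/
structure IsFunctionalHom {E F : Type*} [AddCommGroup E] [Module ℂ E]
    [AddCommGroup F] [Module ℂ F]
    (rE : RightMod A E) (ΘE : Set (E → A)) (rF : RightMod A F) (ΘF : Set (F → A))
    (U : E → F) (Ustar : (E → A) → F → A) : Prop where
  hom : IsModHom rE rF U
  maps_mem : ∀ {φ : E → A}, φ ∈ ΘE → Ustar φ ∈ ΘF
  star_add : ∀ {φ ψ : E → A}, φ ∈ ΘE → ψ ∈ ΘE → Ustar (φ + ψ) = Ustar φ + Ustar ψ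
  star_csmul : ∀ (c : ℂ) {φ : E → A}, φ ∈ ΘE → Ustar (c • φ) = c • Ustar φ
  star_lsmul : ∀ (a : A) {φ : E → A}, φ ∈ ΘE →
      Ustar (fun x => a * φ x) = fun y => a * Ustar φ y
  compat : ∀ {φ : E → A}, φ ∈ ΘE → ∀ x : E, Ustar φ (U x) = φ x

/-- A functional extension. -/
structure IsFunctionalExtension {E F : Type*} [AddCommGroup E] [Module ℂ E]
    [AddCommGroup F] [Module ℂ F]
    (rE : RightMod A E) (ΘE : Set (E → A)) (rF : RightMod A F) (ΘF : Set (F → A))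
    (U : E → F) (Ustar : (E → A) → F → A)
    extends IsFunctionalHom rE ΘE rF ΘF U Ustar : Prop where
  inj : Function.Injective U
  lift : ∀ (k : ℕ) (φ : Fin k → E → A), (∀ i, φ i ∈ ΘE) → ∀ η : F,
      ∃ ξ : E, ∀ i, Ustar (φ i) η = φ i ξ

/-- The elementary compact operator `θ_{η,φ}`. -/
def elemOp {E : Type*} [AddCommGroup E] [Module ℂ E]
    (r : RightMod A E) (η : E) (φ : E → A) : E → E :=
  fun ξ => r.sm η (φ ξ)

/-- The set of compact operators on `(E, r, Θ)`: finite sums of elementary operators. -/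
def KSet {E : Type*} [AddCommGroup E] [Module ℂ E]
    (r : RightMod A E) (Θ : Set (E → A)) : Set (E → E) :=
  { T | ∃ (m : ℕ) (η : Fin m → E) (φ : Fin m → E → A),
      (∀ i, φ i ∈ Θ) ∧ T = ∑ i, elemOp r (η i) (φ i) }

end

section Std

variable (A : Type*) [NonUnitalRing A] [Module ℂ A] [SMulCommClass ℂ A A] [IsScalarTower ℂ A A]

/-- The standard right functional `A`-module structure on `A^n = n →₀ A`
(finitely supported families). -/
noncomputable def stdMod (n : Type*) : RightMod A (n →₀ A) where
  sm x a := Finsupp.mapRange (· * a) (zero_mul a) x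
  add_sm x y a := by ext i; simp [add_mul]
  sm_add x a b := by ext i; simp [mul_add]
  sm_mul x a b := by ext i; simp [mul_assoc]
  csm_left c x a := by ext i; simp [smul_mul_assoc]
  csm_right c x a := by ext i; simp [mul_smul_comm]

/-- The standard functional space on `A^n`: the vectors `x ∈ A^n` acting by
`x(ξ) = Σ_i x_i * ξ_i`. -/
def stdTheta (n : Type*) : Set ((n →₀ A) → A) :=
  { f | ∃ x : n →₀ A, ∀ ξ : n →₀ A, f ξ = x.sum fun i xi => xi * ξ i }

end Std

section Units

variable (A : Type*) [NonUnitalRing A]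

/-- `A` has a left approximate unit (discrete version: finitely many elements
admit a simultaneous left unit). -/
def HasLeftApproxUnit : Prop :=
  ∀ (m : ℕ) (a : Fin m → A), ∃ u : A, ∀ i, u * a i = a i

/-- `A` has a right approximate unit. -/
def HasRightApproxUnit : Prop :=
  ∀ (m : ℕ) (a : Fin m → A), ∃ u : A, ∀ i, a i * u = a i

/-- `A` has a two-sided approximate unit. -/
def HasTwoSidedApproxUnit : Prop :=
  ∀ (m : ℕ) (a : Fin m → A), ∃ u : A, ∀ i, u * a i = a i ∧ a i * u = a i

end Units

section KUnits

variable {A E : Type*} [NonUnitalRing A] [Module ℂ A] [AddCommGroup E] [Module ℂ E]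

/-- The algebra of compact operators of `(E, r, Θ)` has a left approximate unit
(multiplication being composition of operators). -/
def KSetHasLeftApproxUnit (r : RightMod A E) (Θ : Set (E → A)) : Prop :=
  ∀ (m : ℕ) (T : Fin m → E → E), (∀ i, T i ∈ KSet r Θ) →
    ∃ u ∈ KSet r Θ, ∀ i, u ∘ T i = T i

/-- The algebra of compact operators of `(E, r, Θ)` has a right approximate unit. -/
def KSetHasRightApproxUnit (r : RightMod A E) (Θ : Set (E → A)) : Prop :=
  ∀ (m : ℕ) (T : Fin m → E → E), (∀ i, T i ∈ KSet r Θ) →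
    ∃ u ∈ KSet r Θ, ∀ i, T i ∘ u = T i

/-- The algebra of compact operators of `(E, r, Θ)` has a two-sided approximate unit. -/
def KSetHasTwoSidedApproxUnit (r : RightMod A E) (Θ : Set (E → A)) : Prop :=
  ∀ (m : ℕ) (T : Fin m → E → E), (∀ i, T i ∈ KSet r Θ) →
    ∃ u ∈ KSet r Θ, ∀ i, u ∘ T i = T i ∧ T i ∘ u = T i

end KUnits

section Cofull

variable {A E : Type*} [NonUnitalRing A] [Module ℂ A] [AddCommGroup E] [Module ℂ E]

/-- The functional module `E` is cofull. -/
def CofullModule (r : RightMod A E) (Θ : Set (E → A)) : Prop :=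
  ∀ x : E, ∃ (m : ℕ) (ξ η : Fin m → E) (φ : Fin m → E → A),
    (∀ i, φ i ∈ Θ) ∧ x = ∑ i, r.sm (ξ i) (φ i (η i))

/-- The functional space `Θ` is cofull. -/
def CofullTheta (r : RightMod A E) (Θ : Set (E → A)) : Prop :=
  ∀ τ' ∈ Θ, ∃ (m : ℕ) (ξ : Fin m → E) (φ τ : Fin m → E → A),
    (∀ i, φ i ∈ Θ) ∧ (∀ i, τ i ∈ Θ) ∧ τ' = ∑ i, fun x => φ i (ξ i) * τ i x

end Cofull

section ITP

variable {A B E EB : Type*} [NonUnitalRing A] [Module ℂ A] [NonUnitalRing B] [Module ℂ B]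
  [AddCommGroup E] [Module ℂ E] [AddCommGroup EB] [Module ℂ EB]

/-- A (not necessarily unital) algebra homomorphism of ℂ-algebras. -/
def IsAlgHom (π : A → B) : Prop :=
  (∀ x y, π (x + y) = π x + π y) ∧ (∀ x y, π (x * y) = π x * π y) ∧
    ∀ (c : ℂ) (x : A), π (c • x) = c • π x

/-- The defining relations of the internal tensor product `E ⊗_π B`. -/
def itpRelations (π : A → B) (rE : RightMod A E) : Set (TensorProduct ℂ E B) :=
  { z | ∃ (ξ : E) (a : A) (b : B), z = (rE.sm ξ a) ⊗ₜ[ℂ] b - ξ ⊗ₜ[ℂ] (π a * b) }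

/-- `(EB, rEB, t)` realizes the internal tensor product `E ⊗_π B`:
`EB` is, via a ℂ-linear surjection with kernel the span of the defining relations,
the quotient `(E ⊗_ℂ B)/span{ξa ⊗ b − ξ ⊗ π(a)b}`, with `t ξ b` the class of `ξ ⊗ b`,
and the right `B`-action satisfies `(ξ ⊗ b)·b' = ξ ⊗ (bb')`. -/
structure IsInternalTensor (π : A → B) (rE : RightMod A E) (rEB : RightMod B EB)
    (t : E → B → EB) : Prop where
  exists_quot : ∃ q : TensorProduct ℂ E B →ₗ[ℂ] EB, Function.Surjective q ∧
      LinearMap.ker q = Submodule.span ℂ (itpRelations π rE) ∧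
      ∀ (ξ : E) (b : B), t ξ b = q (ξ ⊗ₜ[ℂ] b)
  sm_t : ∀ (ξ : E) (b b' : B), rEB.sm (t ξ b) b' = t ξ (b * b')

/-- The functional space of the internal tensor product `E ⊗_π B`:
the linear span of the functionals `φ ⊗ c` with `(φ ⊗ c)(ξ ⊗ b) = c·π(φ(ξ))·b`. -/
def internalTheta (π : A → B) (ΘE : Set (E → A)) (t : E → B → EB) : Set (EB → B) :=
  ↑(Submodule.span ℂ { h : EB → B | ∃ φ ∈ ΘE, ∃ c : B,
      (∀ x y, h (x + y) = h x + h y) ∧ ∀ (ξ : E) (b : B), h (t ξ b) = c * π (φ ξ) * b })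

end ITP

theorem HasLeftApproxUnit.exists_of_finite {A : Type*} [NonUnitalRing A]
    (hA : HasLeftApproxUnit A) {ι : Type*} [Finite ι]
    (a : ι → A) : ∃ u : A, ∀ i, u * a i = a i := by
  obtain ⟨n, ⟨e⟩⟩ := Finite.exists_equiv_fin ι
  obtain ⟨u, hu⟩ := hA n (a ∘ e.symm)
  exact ⟨u, fun i => by simpa using hu (e i)⟩

section Finite

variable {A E : Type*} [NonUnitalRing A] [Module ℂ A] [AddCommGroup E] [Module ℂ E]

theorem KSetHasRightApproxUnit.exists_of_finite {r : RightMod A E} {Θ : Set (E → A)}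
    (hK : KSetHasRightApproxUnit r Θ) {ι : Type*} [Finite ι] (T : ι → E → E)
    (hT : ∀ i, T i ∈ KSet r Θ) : ∃ u ∈ KSet r Θ, ∀ i, T i ∘ u = T i := by
  obtain ⟨n, ⟨e⟩⟩ := Finite.exists_equiv_fin ι
  obtain ⟨u, hu, h⟩ := hK n (T ∘ e.symm) fun i => hT _
  exact ⟨u, hu, fun i => by simpa using h (e i)⟩

theorem elemOp_mem_KSet (r : RightMod A E) {Θ : Set (E → A)} (η : E) {φ : E → A}
    (hφ : φ ∈ Θ) : elemOp r η φ ∈ KSet r Θ :=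
  ⟨1, fun _ => η, fun _ => φ, fun _ => hφ, by simp⟩

theorem IsFunctional.map_sum {r : RightMod A E} {φ : E → A} (hφ : IsFunctional r φ)
    {ι : Type*} (s : Finset ι) (x : ι → E) : φ (∑ i ∈ s, x i) = ∑ i ∈ s, φ (x i) :=
  _root_.map_sum (AddMonoidHom.mk' φ hφ.1) x s

/-- A left approximate unit of `A` acts as one on a cofull functional space. -/
theorem CofullTheta.exists_left_unit {r : RightMod A E} {Θ : Set (E → A)}
    (hco : CofullTheta r Θ) (hA : HasLeftApproxUnit A) {ι : Type*} [Finite ι]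
    (ψ : ι → E → A) (hψ : ∀ i, ψ i ∈ Θ) : ∃ a : A, ∀ i x, a * ψ i x = ψ i x := by
  choose m ξ φ τ _ _ h using fun i => hco (ψ i) (hψ i)
  obtain ⟨a, ha⟩ := hA.exists_of_finite fun p : Σ i, Fin (m i) => φ p.1 p.2 (ξ p.1 p.2)
  refine ⟨a, fun i x => ?_⟩
  rw [h i]
  simp only [Finset.sum_apply, Finset.mul_sum, ← mul_assoc]
  exact Finset.sum_congr rfl fun j _ => by rw [ha ⟨i, j⟩]

/-- A right approximate unit of the compact operators acts as one on a cofull functional space. -/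
theorem CofullTheta.exists_right_unit {r : RightMod A E} {Θ : Set (E → A)}
    (hco : CofullTheta r Θ) (hΘ : IsFunctionalSpace r Θ) (hK : KSetHasRightApproxUnit r Θ)
    {ι : Type*} [Finite ι] (ψ : ι → E → A) (hψ : ∀ i, ψ i ∈ Θ) :
    ∃ v ∈ KSet r Θ, ∀ i, ψ i ∘ v = ψ i := by
  choose m ξ φ τ hφ hτ h using fun i => hco (ψ i) (hψ i)
  obtain ⟨v, hv, hvT⟩ := hK.exists_of_finite
    (fun p : Σ i, Fin (m i) => elemOp r (ξ p.1 p.2) (τ p.1 p.2))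
    fun p => elemOp_mem_KSet r _ (hτ _ _)
  refine ⟨v, hv, fun i => funext fun x => ?_⟩
  rw [h i]
  simp only [Function.comp_apply, Finset.sum_apply]
  refine Finset.sum_congr rfl fun j _ => ?_
  have hj := congrArg (φ i j) (congrFun (hvT ⟨i, j⟩) x)
  simpa only [Function.comp_apply, elemOp, (hΘ.functional _ (hφ i j)).2.2] using hj

end Finite

section InternalTensor

variable {A B E EB : Type*} [NonUnitalRing A] [Module ℂ A]
  [NonUnitalRing B] [Module ℂ B] [AddCommGroup E] [Module ℂ E] [AddCommGroup EB] [Module ℂ EB]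
  {π : A → B} {rE : RightMod A E} {rEB : RightMod B EB} {t : E → B → EB}

/-- Additive maps out of an internal tensor product agree if they agree on elementary tensors. -/
theorem IsInternalTensor.ext (ht : IsInternalTensor π rE rEB t) {G : Type*} [AddGroup G]
    {f g : EB → G} (hf : ∀ x y, f (x + y) = f x + f y) (hg : ∀ x y, g (x + y) = g x + g y)
    (h : ∀ ξ b, f (t ξ b) = g (t ξ b)) : f = g := by
  obtain ⟨q, hq, -, hqt⟩ := ht.exists_quot
  funext x
  obtain ⟨z, rfl⟩ := hq x
  induction z with
  | zero =>
    rw [map_zero]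
    exact (AddMonoidHom.mk' f hf).map_zero.trans (AddMonoidHom.mk' g hg).map_zero.symm
  | tmul ξ b => rw [← hqt, h]
  | add z w hz hw => rw [map_add, hf, hg, hz, hw]

/-- The functional `φ ⊗ c` on the internal tensor product exists. -/
theorem IsInternalTensor.exists_functional [SMulCommClass ℂ B B] [IsScalarTower ℂ B B]
    (ht : IsInternalTensor π rE rEB t)
    (hπ : IsAlgHom π) {φ : E → A} (hφ : IsFunctional rE φ) (c : B) :
    ∃ h : EB → B, (∀ x y, h (x + y) = h x + h y) ∧
      ∀ (ξ : E) (b : B), h (t ξ b) = c * π (φ ξ) * b := by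
  obtain ⟨q, hq, hker, hqt⟩ := ht.exists_quot
  let f : TensorProduct ℂ E B →ₗ[ℂ] B := TensorProduct.lift <|
    LinearMap.mk₂ ℂ (fun ξ b => c * π (φ ξ) * b)
      (fun x y b => by rw [hφ.1, hπ.1, mul_add, add_mul])
      (fun k x b => by rw [hφ.2.1, hπ.2.2, mul_smul_comm, smul_mul_assoc])
      (fun x b d => mul_add _ _ _)
      (fun k x b => mul_smul_comm _ _ _)
  have hf : ∀ ξ b, f (ξ ⊗ₜ[ℂ] b) = c * π (φ ξ) * b := fun ξ b => by simp [f]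
  have hle : LinearMap.ker q ≤ LinearMap.ker f := by
    rw [hker, Submodule.span_le]
    rintro _ ⟨ξ, a, b, rfl⟩
    simp only [SetLike.mem_coe, LinearMap.mem_ker, map_sub, hf, hφ.2.2, hπ.2.1, mul_assoc, sub_self]
  have hs : ∀ z, f (Function.surjInv hq (q z)) = f z := fun z => by
    have : Function.surjInv hq (q z) - z ∈ LinearMap.ker f :=
      hle (by rw [LinearMap.mem_ker, map_sub, Function.surjInv_eq hq, sub_self])
    rwa [LinearMap.mem_ker, map_sub, sub_eq_zero] at this
  refine ⟨fun x => f (Function.surjInv hq x), fun x y => ?_, fun ξ b => ?_⟩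
  · obtain ⟨z, rfl⟩ := hq x
    obtain ⟨w, rfl⟩ := hq y
    simp only [← map_add, hs]
  · simp only [hqt, hs, hf]

/-- A single compact operator on the internal tensor product fixes all functionals `φ ⊗ c`
with `φ` in a given finite family. -/
theorem IsInternalTensor.exists_unit_of_finite [SMulCommClass ℂ B B] [IsScalarTower ℂ B B]
    (ht : IsInternalTensor π rE rEB t)
    (hπ : IsAlgHom π) {Θ : Set (E → A)} (hΘ : IsFunctionalSpace rE Θ) (hco : CofullTheta rE Θ)
    (hA : HasLeftApproxUnit A) (hK : KSetHasRightApproxUnit rE Θ) {ι : Type*} [Finite ι]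
    (φ : ι → E → A) (hφ : ∀ i, φ i ∈ Θ) :
    ∃ u ∈ KSet rEB (internalTheta π Θ t), ∀ (i : ι) (c : B) (h : EB → B),
      (∀ x y, h (x + y) = h x + h y) → (∀ ξ b, h (t ξ b) = c * π (φ i ξ) * b) → h ∘ u = h := by
  obtain ⟨v, ⟨m, η, ψ, hψ, rfl⟩, hv⟩ := hco.exists_right_unit hΘ hK φ hφ
  obtain ⟨a, ha⟩ := hco.exists_left_unit hA ψ hψ
  choose g hgadd hg using fun j => ht.exists_functional hπ (hΘ.functional _ (hψ j)) (π a)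
  refine ⟨∑ j, elemOp rEB (t (η j) (π a)) (g j), ⟨m, _, g, fun j => Submodule.subset_span
    ⟨ψ j, hψ j, π a, hgadd j, hg j⟩, rfl⟩, fun i c h hadd ht' => ?_⟩
  have hsum : ∀ x : Fin m → EB, h (∑ j, x j) = ∑ j, h (x j) := fun x =>
    map_sum (AddMonoidHom.mk' h hadd) x _
  have πsum : ∀ x : Fin m → A, π (∑ j, x j) = ∑ j, π (x j) := fun x =>
    map_sum (AddMonoidHom.mk' π hπ.1) x _
  refine ht.ext (fun x y => ?_) hadd fun ξ b => ?_
  · simp only [Function.comp_apply, Finset.sum_apply, elemOp, hgadd, rEB.sm_add,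
      Finset.sum_add_distrib, hadd]
  · have hvξ : φ i ξ = ∑ j, φ i (η j) * ψ j ξ := by
      conv_lhs => rw [← hv i]
      simp only [Function.comp_apply, Finset.sum_apply, elemOp,
        (hΘ.functional _ (hφ i)).map_sum, (hΘ.functional _ (hφ i)).2.2]
    simp only [Function.comp_apply, Finset.sum_apply, elemOp, hsum, hg, ht.sm_t, ht']
    rw [hvξ, πsum, Finset.mul_sum, Finset.sum_mul]
    refine Finset.sum_congr rfl fun j _ => ?_
    rw [← hπ.2.1, ha, ← mul_assoc (π a), ← hπ.2.1, ha, hπ.2.1]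
    simp only [mul_assoc]

end InternalTensor

/-- If the functional space of `E` is cofull, `A` has a left approximate unit and `K_A(E)` has a right approximate unit, then for any algebra homomorphism `π : A → B`, the algebra `K_B(E ⊗_π B)` has a right approximate unit. -/
theorem internalTensor_hasRightApproxUnit
    {A B E EB : Type*} [NonUnitalRing A] [Module ℂ A]
    [SMulCommClass ℂ A A] [IsScalarTower ℂ A A]
    [NonUnitalRing B] [Module ℂ B] [SMulCommClass ℂ B B] [IsScalarTower ℂ B B]
    [AddCommGroup E] [Module ℂ E] [AddCommGroup EB] [Module ℂ EB]
    (rE : RightMod A E) (ΘE : Set (E → A)) (hE : IsFunctionalSpace rE ΘE)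
    (hcoθ : CofullTheta rE ΘE)
    (hA : HasLeftApproxUnit A)
    (hK : KSetHasRightApproxUnit rE ΘE)
    (π : A → B) (hπ : IsAlgHom π)
    (rEB : RightMod B EB) (t : E → B → EB)
    (ht : IsInternalTensor π rE rEB t) :
    KSetHasRightApproxUnit rEB (internalTheta π ΘE t) := by
  intro m T hT
  choose n η h hh hTsum using hT
  choose S hS hmem using fun p : Σ i, Fin (n i) =>
    Submodule.mem_span_finite_of_mem_span (hh p.1 p.2)
  choose φ hφ c hadd hc using fun (p : Σ i, Fin (n i)) (f : S p) => hS p f.2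
  obtain ⟨u, hu, hfix⟩ := ht.exists_unit_of_finite hπ hE hcoθ hA hK
    (fun s : Σ p, S p => φ s.1 s.2) fun s => hφ s.1 s.2
  have hhu : ∀ i j, h i j ∘ u = h i j := fun i j =>
    (Submodule.span_le (p := LinearMap.eqLocus (LinearMap.funLeft ℂ B u) LinearMap.id)).2
      (fun f hf => hfix ⟨⟨i, j⟩, ⟨f, hf⟩⟩ (c ⟨i, j⟩ ⟨f, hf⟩) f (hadd ⟨i, j⟩ ⟨f, hf⟩)
        (hc ⟨i, j⟩ ⟨f, hf⟩)) (hmem ⟨i, j⟩)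
  refine ⟨u, hu, fun i => funext fun x => ?_⟩
  simp only [hTsum i, Function.comp_apply, Finset.sum_apply, elemOp]
  exact Finset.sum_congr rfl fun j _ => congrArg _ (congrFun (hhu i j) x)
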